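/- arXiv:2502.09273 — 4 statements merged into one kernel-verified Lean document; each statement's English description precedes it below -/
import Mathlib

section
/- Let E, P, C be real-valued random variables on a probability space (Ω, 𝒜, ℙ) such that C is independent of the pair (E, P). Then for every t ∈ ℝ, almost surely, 𝔼[1{min(E,P) ≥ t} · 1{C ≥ t} | σ(E,C)] = 1{E ≥ t} · 1{C ≥ t} · 𝔼[1{P ≥ t} | σ(E)]. (This is the exact conditional-expectation identity underlying the paper's Lemma 'Excess survival processes', item (ii): the conditional expectation of the at-risk process Y(t) = 1{min(E,P) ≥ t, C ≥ t} given σ(E,C) equals the excess at-risk process Y_E(t) = 1{E ≥ t, C ≥ t} multiplied by the conditional probability that P ≥ t given E.) -/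
open MeasureTheory ProbabilityTheory Filter Set

/-- Set integrals over `E⁻¹A ∩ C⁻¹B` factorize. -/
theorem aux_factor
    {Ω : Type*} [MeasurableSpace Ω] (μ : Measure Ω) [IsProbabilityMeasure μ]
    (E P C : Ω → ℝ) (hE : Measurable E) (hP : Measurable P) (hC : Measurable C)
    (hindep : IndepFun C (fun ω => (E ω, P ω)) μ) (F : ℝ × ℝ → ℝ) (hF : Measurable F)
    (A B : Set ℝ) (hA : MeasurableSet A) (hB : MeasurableSet B) :
    ∫ ω in (fun ω => (E ω, C ω)) ⁻¹' (A ×ˢ B), F (E ω, P ω) ∂μ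
      = (∫ ω, B.indicator 1 (C ω) ∂μ) * ∫ ω in E ⁻¹' A, F (E ω, P ω) ∂μ := by
  have hG : Measurable ((A ×ˢ (univ : Set ℝ)).indicator F) :=
    hF.indicator (hA.prod MeasurableSet.univ)
  have hBm : Measurable (B.indicator (1 : ℝ → ℝ)) := measurable_one.indicator hB
  have hi := (hindep.comp hBm hG).integral_mul_eq_mul_integral
    (hBm.comp hC).aestronglyMeasurable (hG.comp (hE.prodMk hP)).aestronglyMeasurable
  rw [← integral_indicator ((hE.prodMk hC) (hA.prod hB)), ← integral_indicator (hE hA)]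
  refine Eq.trans ?_ (hi.trans ?_)
  · congr 1
    ext ω
    by_cases h1 : E ω ∈ A <;> by_cases h2 : C ω ∈ B <;> simp [indicator, h1, h2]
  · congr 2
    ext ω
    by_cases h1 : E ω ∈ A <;> simp [indicator, h1]

theorem aux_condexp
    {Ω : Type*} [MeasurableSpace Ω] (μ : Measure Ω) [IsProbabilityMeasure μ]
    (E P C : Ω → ℝ) (hE : Measurable E) (hP : Measurable P) (hC : Measurable C)
    (hindep : IndepFun C (fun ω => (E ω, P ω)) μ) (g : ℝ → ℝ) (hg : Measurable g)
    (hgi : Integrable (fun ω => g (P ω)) μ) :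
    μ[(fun ω => g (P ω)) | MeasurableSpace.comap (fun ω => (E ω, C ω)) inferInstance]
      =ᵐ[μ] μ[(fun ω => g (P ω)) | MeasurableSpace.comap E inferInstance] := by
  set h := μ[(fun ω => g (P ω)) | MeasurableSpace.comap E inferInstance] with hh
  have hm : MeasurableSpace.comap (fun ω => (E ω, C ω)) inferInstance ≤ ‹MeasurableSpace Ω› :=
    (hE.prodMk hC).comap_le
  have hsm : StronglyMeasurable[MeasurableSpace.comap E inferInstance] h :=
    stronglyMeasurable_condExp
  obtain ⟨φ, hφ, hφE⟩ := hsm.measurable.exists_eq_measurable_comp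
  have hint : Integrable h μ := integrable_condExp
  have hle : MeasurableSpace.comap E inferInstance ≤
      MeasurableSpace.comap (fun ω => (E ω, C ω)) inferInstance := by
    rintro _ ⟨s, hs, rfl⟩
    exact ⟨Prod.fst ⁻¹' s, measurable_fst hs, rfl⟩
  have key : ∀ S : Set (ℝ × ℝ), MeasurableSet S →
      ∫ ω in (fun ω => (E ω, C ω)) ⁻¹' S, h ω ∂μ
        = ∫ ω in (fun ω => (E ω, C ω)) ⁻¹' S, g (P ω) ∂μ := by
    have hbase : ∀ A B : Set ℝ, MeasurableSet A → MeasurableSet B →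
        ∫ ω in (fun ω => (E ω, C ω)) ⁻¹' (A ×ˢ B), h ω ∂μ
        = ∫ ω in (fun ω => (E ω, C ω)) ⁻¹' (A ×ˢ B), g (P ω) ∂μ := by
      intro A B hA hB
      have h1 := aux_factor μ E P C hE hP hC hindep (fun p => φ p.1)
        (hφ.comp measurable_fst) A B hA hB
      have h2 := aux_factor μ E P C hE hP hC hindep (fun p => g p.2)
        (hg.comp measurable_snd) A B hA hB
      have h3 : ∫ ω in E ⁻¹' A, h ω ∂μ = ∫ ω in E ⁻¹' A, g (P ω) ∂μ :=
        setIntegral_condExp hE.comap_le hgi ⟨A, hA, rfl⟩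
      have h4 : ∀ ω, φ (E ω) = h ω := fun ω => (congrFun hφE ω).symm
      simp only [h4] at h1
      rw [h1, h2, h3]
    have huniv := hbase univ univ MeasurableSet.univ MeasurableSet.univ
    simp only [univ_prod_univ, preimage_univ, setIntegral_univ] at huniv
    intro S hS
    induction S, hS using MeasurableSpace.induction_on_inter
      generateFrom_prod.symm isPiSystem_prod with
    | empty => simp
    | basic S hS =>
      obtain ⟨A, hA, B, hB, rfl⟩ := hS
      exact hbase A B hA hB
    | compl S hS ih =>
      have hS' := (hE.prodMk hC) hS
      rw [preimage_compl, setIntegral_compl hS' hint, setIntegral_compl hS' hgi, ih, huniv]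
    | iUnion f hd hf ih =>
      have hf' := fun i => (hE.prodMk hC) (hf i)
      have hd' : Pairwise (Function.onFun Disjoint
          fun i => (fun ω => (E ω, C ω)) ⁻¹' (f i)) :=
        fun i j hij => (hd hij).preimage _
      rw [preimage_iUnion, integral_iUnion hf' hd' hint.integrableOn,
        integral_iUnion hf' hd' hgi.integrableOn]
      exact tsum_congr ih
  refine (ae_eq_condExp_of_forall_setIntegral_eq hm hgi (fun _ _ _ => hint.integrableOn)
    ?_ (hsm.mono hle).aestronglyMeasurable).symm
  rintro _ ⟨S, hS, rfl⟩ _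
  exact key S hS

/-- Let `E, P, C` be real random variables on a probability space `(Ω, 𝒜, μ)`
with `C` independent of the pair `(E, P)`. Then for every `t : ℝ`, almost surely,
`𝔼[1{min(E,P) ≥ t} · 1{C ≥ t} | σ(E,C)] = 1{E ≥ t} · 1{C ≥ t} · 𝔼[1{P ≥ t} | σ(E)]`. -/
theorem excess_at_risk_condexp
    {Ω : Type*} [MeasurableSpace Ω] (μ : Measure Ω) [IsProbabilityMeasure μ]
    (E P C : Ω → ℝ) (hE : Measurable E) (hP : Measurable P) (hC : Measurable C)
    (hindep : IndepFun C (fun ω => (E ω, P ω)) μ) (t : ℝ) :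
    μ[(fun ω => (if t ≤ min (E ω) (P ω) then (1:ℝ) else 0) * (if t ≤ C ω then (1:ℝ) else 0)) |
        MeasurableSpace.comap (fun ω => (E ω, C ω)) inferInstance]
      =ᵐ[μ]
    fun ω => (if t ≤ E ω then (1:ℝ) else 0) * (if t ≤ C ω then (1:ℝ) else 0) *
      (μ[(fun ω => if t ≤ P ω then (1:ℝ) else 0) |
          MeasurableSpace.comap E inferInstance]) ω := by

  have hmeas : Measurable fun x : ℝ => if t ≤ x then (1:ℝ) else 0 :=
    Measurable.ite measurableSet_Ici measurable_const measurable_const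
  have hb : ∀ x : ℝ, ‖(if t ≤ x then (1:ℝ) else 0)‖ ≤ 1 := by
    intro x; split_ifs <;> simp
  have hgi : Integrable (fun ω => if t ≤ P ω then (1:ℝ) else 0) μ :=
    Integrable.of_bound (hmeas.comp hP).aestronglyMeasurable 1 (ae_of_all _ fun ω => hb _)
  have haux := aux_condexp μ E P C hE hP hC hindep _ hmeas hgi
  have hk : Measurable fun p : ℝ × ℝ =>
      (if t ≤ p.1 then (1:ℝ) else 0) * (if t ≤ p.2 then (1:ℝ) else 0) :=
    (hmeas.comp measurable_fst).mul (hmeas.comp measurable_snd)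
  have hf : StronglyMeasurable[MeasurableSpace.comap (fun ω => (E ω, C ω)) inferInstance]
      (fun ω => (if t ≤ E ω then (1:ℝ) else 0) * (if t ≤ C ω then (1:ℝ) else 0)) :=
    (hk.comp (comap_measurable (fun ω => (E ω, C ω)))).stronglyMeasurable
  have heq : (fun ω => (if t ≤ min (E ω) (P ω) then (1:ℝ) else 0) *
        (if t ≤ C ω then (1:ℝ) else 0))
      = (fun ω => (if t ≤ E ω then (1:ℝ) else 0) * (if t ≤ C ω then (1:ℝ) else 0)) *
        (fun ω => if t ≤ P ω then (1:ℝ) else 0) := by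
    ext ω
    by_cases h1 : t ≤ E ω <;> by_cases h2 : t ≤ P ω <;> simp [h1, h2]
  have hfgi : Integrable ((fun ω => (if t ≤ E ω then (1:ℝ) else 0) *
      (if t ≤ C ω then (1:ℝ) else 0)) * (fun ω => if t ≤ P ω then (1:ℝ) else 0)) μ := by
    refine Integrable.of_bound
      (((hk.comp (hE.prodMk hC)).mul (hmeas.comp hP)).aestronglyMeasurable) 1
      (ae_of_all _ fun ω => ?_)
    simp only [Pi.mul_apply]
    split_ifs <;> simp
  rw [heq]
  refine (condExp_mul_of_stronglyMeasurable_left hf hfgi hgi).trans ?_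
  filter_upwards [haux] with ω hω
  simp only [Pi.mul_apply]
  rw [hω]
end

section
/- Let g_O be any probability density of O = min(E,P). Then for almost every t ≥ 0 such that f_E(t) > 0, S_E(t) > 0, S_O(t) > 0 and a(t) > 0, the excess hazard satisfies λ_E(t) = (c(t)/a(t)) · ( g_O(t)/S_O(t) − b(t)/c(t) ), i.e. the excess hazard rate equals (c/a) times the overall hazard rate minus b/a. (This is item (iii) of the paper's Lemma 'Excess survival processes': ∂Λ_E(t) = (c(t)/a(t))(∂Λ_O(t) − b(t)/c(t)).) -/
open MeasureTheory ProbabilityTheory Filter Set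

lemma min_density_aux (F : ℝ × ℝ → ENNReal) (hF : Measurable F) :
    Measure.map (fun p : ℝ × ℝ => min p.1 p.2) (volume.withDensity F)
      = volume.withDensity (fun t => (∫⁻ y in Set.Ioi t, F (t, y)) + ∫⁻ x in Set.Ioi t, F (x, t)) ∧
    Measurable (fun t => (∫⁻ y in Set.Ioi t, F (t, y)) + ∫⁻ x in Set.Ioi t, F (x, t)) := by
  have hA : MeasurableSet {p : ℝ × ℝ | p.1 < p.2} := measurableSet_lt measurable_fst measurable_snd
  have hB : MeasurableSet {p : ℝ × ℝ | p.2 ≤ p.1} := measurableSet_le measurable_snd measurable_fst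
  have h1 : ∀ t, (∫⁻ y in Set.Ioi t, F (t, y)) = ∫⁻ y, {p : ℝ × ℝ | p.1 < p.2}.indicator F (t, y) := by
    intro t
    rw [← lintegral_indicator measurableSet_Ioi]
    rfl
  have h2 : ∀ t, (∫⁻ x in Set.Ioi t, F (x, t)) = ∫⁻ x, {p : ℝ × ℝ | p.2 ≤ p.1}.indicator F (x, t) := by
    intro t
    rw [setLIntegral_congr Ioi_ae_eq_Ici, ← lintegral_indicator measurableSet_Ici]
    rfl
  have m1 : Measurable (fun t => ∫⁻ y in Set.Ioi t, F (t, y)) := by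
    simp_rw [h1]
    exact (hF.indicator hA).lintegral_prod_right'
  have m2 : Measurable (fun t => ∫⁻ x in Set.Ioi t, F (x, t)) := by
    simp_rw [h2]
    exact (hF.indicator hB).lintegral_prod_left'
  refine ⟨?_, m1.add m2⟩
  ext s hs
  have hm : Measurable (fun p : ℝ × ℝ => min p.1 p.2) := measurable_fst.min measurable_snd
  rw [Measure.map_apply hm hs, withDensity_apply _ (hm hs), withDensity_apply _ hs,
    lintegral_add_left m1, ← lintegral_indicator (hm hs), ← lintegral_indicator hs,
    ← lintegral_indicator hs]
  have hs1 : MeasurableSet {p : ℝ × ℝ | p.1 ∈ s} := measurable_fst hs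
  have hs2 : MeasurableSet {p : ℝ × ℝ | p.2 ∈ s} := measurable_snd hs
  have key : ∀ p, ((fun p : ℝ × ℝ => min p.1 p.2) ⁻¹' s).indicator F p =
      {p : ℝ × ℝ | p.1 ∈ s}.indicator ({p : ℝ × ℝ | p.1 < p.2}.indicator F) p
      + {p : ℝ × ℝ | p.2 ∈ s}.indicator ({p : ℝ × ℝ | p.2 ≤ p.1}.indicator F) p := by
    intro p
    rcases lt_or_ge p.1 p.2 with h | h
    · by_cases hp : p.1 ∈ s <;> simp [Set.indicator, hp, h, min_eq_left h.le, not_le.2 h]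
    · by_cases hp : p.2 ∈ s <;> simp [Set.indicator, hp, h, min_eq_right h, not_lt.2 h]
  simp_rw [key]
  rw [lintegral_add_left ((hF.indicator hA).indicator hs1)]
  congr 1
  · rw [Measure.volume_eq_prod, lintegral_prod _ ((hF.indicator hA).indicator hs1).aemeasurable]
    refine lintegral_congr fun t => ?_
    by_cases ht : t ∈ s
    · simp only [indicator_of_mem ht, h1]
      refine lintegral_congr fun y => ?_
      rw [indicator_of_mem]; exact ht
    · rw [indicator_of_notMem ht]
      simp [indicator_apply, ht]
  · rw [Measure.volume_eq_prod, lintegral_prod_symm _ ((hF.indicator hB).indicator hs2).aemeasurable]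
    refine lintegral_congr fun t => ?_
    by_cases ht : t ∈ s
    · simp only [indicator_of_mem ht, h2]
      refine lintegral_congr fun y => ?_
      rw [indicator_of_mem]; exact ht
    · rw [indicator_of_notMem ht]
      simp [indicator_apply, ht]


/-- With `(E,P)` having joint density `f` on `(0,∞)²` and `g_O` any probability
density of `O = min(E,P)`, for almost every `t ≥ 0` such that `f_E(t) > 0`, `S_E(t) > 0`,
`S_O(t) > 0` and `a(t) > 0`, the excess hazard satisfies
`λ_E(t) = (c(t)/a(t)) · (g_O(t)/S_O(t) − b(t)/c(t))`. -/
theorem excess_hazard_formula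
    {Ω : Type*} [MeasurableSpace Ω] (μ : Measure Ω) [IsProbabilityMeasure μ]
    (E P : Ω → ℝ) (hE : Measurable E) (hP : Measurable P)
    (hEpos : ∀ᵐ ω ∂μ, 0 < E ω) (hPpos : ∀ᵐ ω ∂μ, 0 < P ω)
    (f : ℝ × ℝ → ℝ) (hf_meas : Measurable f) (hf_nonneg : ∀ p, 0 ≤ f p)
    (hf_supp : ∀ p : ℝ × ℝ, p ∉ Set.Ioi (0:ℝ) ×ˢ Set.Ioi (0:ℝ) → f p = 0)
    (hf_int : Integrable f volume)
    (hdens : Measure.map (fun ω => (E ω, P ω)) μ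
      = volume.withDensity (fun p => ENNReal.ofReal (f p)))
    (gO : ℝ → ℝ) (hgO_meas : Measurable gO) (hgO_nonneg : ∀ t, 0 ≤ gO t)
    (hgO_dens : Measure.map (fun ω => min (E ω) (P ω)) μ
      = volume.withDensity (fun t => ENNReal.ofReal (gO t))) :
    -- the relative-survival coefficients and hazards
    ∀ fE SE SO a b c lamE : ℝ → ℝ,
      (∀ t, fE t = ∫ y in Set.Ioi (0:ℝ), f (t, y)) →
      (∀ t, SE t = ∫ x in Set.Ioi t, fE x) →
      (∀ t, SO t = (μ {ω | t < min (E ω) (P ω)}).toReal) →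
      (∀ t, a t = (∫ y in Set.Ioi t, f (t, y)) / fE t) →
      (∀ t, b t = (∫ x in Set.Ioi t, f (x, t)) / SE t) →
      (∀ t, c t = SO t / SE t) →
      (∀ t, lamE t = fE t / SE t) →
      ∀ᵐ t ∂(volume.restrict (Set.Ici (0:ℝ))),
        0 < fE t → 0 < SE t → 0 < SO t → 0 < a t →
          lamE t = (c t / a t) * (gO t / SO t - b t / c t) := by
  intro fE SE SO a b c lamE _ _ _ ha hb hc hl
  obtain ⟨k, km⟩ := min_density_aux (fun p => ENNReal.ofReal (f p)) hf_meas.ennreal_ofReal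
  rw [← hdens, Measure.map_map (measurable_fst.min measurable_snd) (hE.prodMk hP)] at k
  have k2 := hgO_dens.symm.trans k
  rw [withDensity_eq_iff_of_sigmaFinite hgO_meas.ennreal_ofReal.aemeasurable km.aemeasurable] at k2
  refine ae_restrict_of_ae ?_
  filter_upwards [k2] with t ht h1 h2 h3 h4
  have hfin : (∫⁻ y in Set.Ioi t, ENNReal.ofReal (f (t, y)))
      + (∫⁻ x in Set.Ioi t, ENNReal.ofReal (f (x, t))) ≠ ⊤ := by
    rw [← ht]; exact ENNReal.ofReal_ne_top
  rw [ENNReal.add_ne_top] at hfin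
  have hg : gO t = (∫ y in Set.Ioi t, f (t, y)) + ∫ x in Set.Ioi t, f (x, t) := by
    rw [integral_eq_lintegral_of_nonneg_ae (ae_of_all _ fun _ => hf_nonneg _)
        (hf_meas.comp measurable_prodMk_left).aestronglyMeasurable,
      integral_eq_lintegral_of_nonneg_ae (ae_of_all _ fun _ => hf_nonneg _)
        (hf_meas.comp measurable_prodMk_right).aestronglyMeasurable,
      ← ENNReal.toReal_add hfin.1 hfin.2, ← ht, ENNReal.toReal_ofReal (hgO_nonneg t)]
  have hA : (∫ y in Set.Ioi t, f (t, y)) = a t * fE t := by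
    rw [ha]; field_simp
  have hB : (∫ x in Set.Ioi t, f (x, t)) = b t * SE t := by
    rw [hb]; field_simp
  rw [hA, hB] at hg
  rw [hl, hc, hg]
  field_simp
  ring
end

section
/- For almost every t ≥ 0 with f_E(t) > 0, one has ∫_t^∞ f(t,y) dy = f_E(t) · ∂₁𝒞(S_E(t), S_P(t)), i.e. a(t) = ∂₁𝒞(S_E(t), S_P(t)); and for almost every t ≥ 0, one has ∫_t^∞ f(x,t) dx = f_P(t) · ∂₂𝒞(S_E(t), S_P(t)), so that for S_E(t) > 0, b(t) = ∂₂𝒞(S_E(t), S_P(t)) · f_P(t)/S_E(t). (These are the paper's closed-form expressions of the coefficients a and b in terms of the partial derivatives of the survival copula: a(t) = 𝒞₁(S_E(t),S_P(t)) and b(t) = −𝒞₂(S_E(t),S_P(t)) ∂S_P(t)/S_E(t).) -/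
open MeasureTheory ProbabilityTheory Filter Set

lemma tail_eq (h : ℝ → ℝ) (hh : Integrable h volume) (t : ℝ) :
    ∫ y in Ioi t, h y = (∫ y in Ioi (0:ℝ), h y) - ∫ y in (0:ℝ)..t, h y := by
  rw [← intervalIntegral.integral_Ioi_sub_Ioi' hh.integrableOn hh.integrableOn]
  ring

lemma tail_cont (h : ℝ → ℝ) (hh : Integrable h volume) :
    Continuous (fun t => ∫ y in Ioi t, h y) := by
  rw [funext (tail_eq h hh)]
  exact continuous_const.sub
    (intervalIntegral.continuous_primitive (fun a b => hh.intervalIntegrable) 0)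

lemma tail_deriv (h : ℝ → ℝ) (hh : Integrable h volume) :
    ∀ᵐ t, HasDerivAt (fun t => ∫ y in Ioi t, h y) (-h t) t := by
  rw [funext (tail_eq h hh)]
  filter_upwards [LocallyIntegrable.ae_hasDerivAt_integral hh.locallyIntegrable] with t ht
  exact (ht 0).const_sub _

lemma part_int (f : ℝ × ℝ → ℝ) (hf : Integrable f volume) (q : ℝ) :
    Integrable (fun x => ∫ y in Ioi q, f (x, y)) volume := by
  have : Integrable f ((volume : Measure ℝ).prod (volume.restrict (Ioi q))) := by
    have h := hf.integrableOn (s := univ ×ˢ Ioi q)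
    rw [IntegrableOn, Measure.volume_eq_prod, ← Measure.prod_restrict, Measure.restrict_univ] at h
    exact h
  exact this.integral_prod_left

lemma key (f : ℝ × ℝ → ℝ) (hf_nonneg : ∀ p, 0 ≤ f p) (hf_int : Integrable f volume)
    (C : ℝ × ℝ → ℝ) (hC : ContDiffOn ℝ 1 C (Icc (0:ℝ) 1 ×ˢ Icc (0:ℝ) 1))
    (fE SE SP : ℝ → ℝ) (hfE : ∀ t, fE t = ∫ y in Ioi (0:ℝ), f (t, y))
    (hSE : ∀ t, SE t = ∫ x in Ioi t, fE x)
    (hSE01 : ∀ t, SE t ∈ Icc (0:ℝ) 1) (hSP01 : ∀ t, SP t ∈ Icc (0:ℝ) 1)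
    (hSP : Continuous SP)
    (hcop : ∀ s t : ℝ, 0 ≤ s → 0 ≤ t →
      ∫ x in Ioi s, ∫ y in Ioi t, f (x, y) = C (SE s, SP t)) :
    ∀ᵐ t ∂(volume.restrict (Ici (0:ℝ))),
      (∫ y in Ioi t, f (t, y)) = fE t * deriv (fun x => C (x, SP t)) (SE t) := by
  have hfEi : Integrable fE volume := by
    rw [funext hfE]; exact part_int f hf_int 0
  have h1 : ∀ᵐ t : ℝ, ∀ q : ℚ, HasDerivAt (fun s => ∫ x in Ioi s, ∫ y in Ioi (max (q:ℝ) 0), f (x, y))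
      (-∫ y in Ioi (max (q:ℝ) 0), f (t, y)) t :=
    ae_all_iff.2 fun q => tail_deriv _ (part_int f hf_int _)
  have h2 : ∀ᵐ t : ℝ, HasDerivAt SE (-fE t) t := by
    rw [funext hSE]; exact tail_deriv _ hfEi
  have h3 : ∀ᵐ t : ℝ, Integrable (fun y => f (t, y)) volume := by
    rw [Measure.volume_eq_prod] at hf_int
    exact hf_int.prod_right_ae
  have h4 : ∀ᵐ t : ℝ, t ≠ 0 := by simp [ae_iff, measure_singleton]
  rw [ae_restrict_iff' measurableSet_Ici]
  filter_upwards [h1, h2, h3, h4] with s h1 h2 h3 h4 hs0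
  have hs : 0 < s := lt_of_le_of_ne hs0 (Ne.symm h4)
  rcases eq_or_ne (fE s) 0 with h0 | h0
  · rw [h0, zero_mul]
    refine le_antisymm ?_ (integral_nonneg fun y => hf_nonneg _)
    rw [← h0, hfE]
    exact setIntegral_mono_set h3.integrableOn (Eventually.of_forall fun y => hf_nonneg _)
      (Ioi_subset_Ioi hs.le).eventuallyLE
  have hu : SE s ∈ Ioo (0:ℝ) 1 := by
    refine ⟨lt_of_le_of_ne (hSE01 s).1 fun h => h0 ?_, lt_of_le_of_ne (hSE01 s).2 fun h => h0 ?_⟩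
    · have : IsLocalMin SE s := Eventually.of_forall fun y => h ▸ (hSE01 y).1
      simpa using this.hasDerivAt_eq_zero h2
    · have : IsLocalMax SE s := Eventually.of_forall fun y => h ▸ (hSE01 y).2
      simpa using this.hasDerivAt_eq_zero h2
  set K := Icc (0:ℝ) 1 ×ˢ Icc (0:ℝ) 1 with hK
  have hD : ∀ v ∈ Icc (0:ℝ) 1,
      HasDerivAt (fun x => C (x, v)) (fderivWithin ℝ C K (SE s, v) (1, 0)) (SE s) := by
    intro v hv
    have hm : (SE s, v) ∈ K := ⟨hSE01 s, hv⟩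
    have hd := ((hC.differentiableOn one_ne_zero) _ hm).hasFDerivWithinAt
    have hl : HasDerivWithinAt (fun x : ℝ => (x, v)) ((1:ℝ), (0:ℝ)) (Icc 0 1) (SE s) :=
      ((hasDerivAt_id (SE s)).prodMk (hasDerivAt_const (SE s) v)).hasDerivWithinAt
    have := hd.comp_hasDerivWithinAt (SE s) hl
      (show MapsTo (fun x : ℝ => (x, v)) (Icc 0 1) K from fun x hx => ⟨hx, hv⟩)
    exact this.hasDerivAt (Icc_mem_nhds hu.1 hu.2)
  rw [(hD _ (hSP01 s)).deriv]
  have hcont : Continuous fun t => fderivWithin ℝ C K (SE s, SP t) (1, 0) := by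
    have hc := hC.continuousOn_fderivWithin
      (uniqueDiffOn_Icc_zero_one.prod uniqueDiffOn_Icc_zero_one) le_rfl
    have := hc.comp_continuous (f := fun t => (SE s, SP t)) (by fun_prop)
      (fun t => ⟨hSE01 s, hSP01 t⟩)
    exact this.clm_apply continuous_const
  have hφ := tail_cont _ h3
  have heq : (fun r : ℝ => ∫ y in Ioi (max r 0), f (s, y)) =
      fun r : ℝ => fE s * fderivWithin ℝ C K (SE s, SP (max r 0)) (1, 0) := by
    have hm : Continuous fun r : ℝ => max r 0 := by fun_prop
    refine Continuous.ext_on (s := range ((↑) : ℚ → ℝ)) Rat.denseRange_cast (hφ.comp hm)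
      (continuous_const.mul (hcont.comp hm)) ?_
    rintro _ ⟨q, rfl⟩
    have e1 := h1 q
    have e2 := (hD _ (hSP01 (max (q:ℝ) 0))).comp s h2
    have e3 := e2.congr_of_eventuallyEq
      (f₁ := fun s => ∫ x in Ioi s, ∫ y in Ioi (max (q:ℝ) 0), f (x, y)) (by
        filter_upwards [Ioi_mem_nhds hs] with r hr
        exact hcop r _ (le_of_lt hr) (le_max_right _ _))
    have := e1.unique e3
    dsimp only
    linarith
  have := congrFun heq s
  simpa [max_eq_left hs.le] using this

/-- Closed-form expressions of the relative-survival coefficients `a` and `b`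
in terms of the partial derivatives of the survival copula `𝒞` of `(E,P)`:
for a.e. `t ≥ 0` with `f_E(t) > 0`, `∫_t^∞ f(t,y)dy = f_E(t)·∂₁𝒞(S_E(t),S_P(t))`,
i.e. `a(t) = ∂₁𝒞(S_E(t),S_P(t))`; and for a.e. `t ≥ 0`,
`∫_t^∞ f(x,t)dx = f_P(t)·∂₂𝒞(S_E(t),S_P(t))`, so that for `S_E(t) > 0`,
`b(t) = ∂₂𝒞(S_E(t),S_P(t))·f_P(t)/S_E(t)`. -/
theorem copula_coefficients
    {Ω : Type*} [MeasurableSpace Ω] (μ : Measure Ω) [IsProbabilityMeasure μ]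
    (E P : Ω → ℝ) (hE : Measurable E) (hP : Measurable P)
    (hEpos : ∀ᵐ ω ∂μ, 0 < E ω) (hPpos : ∀ᵐ ω ∂μ, 0 < P ω)
    (f : ℝ × ℝ → ℝ) (hf_meas : Measurable f) (hf_nonneg : ∀ p, 0 ≤ f p)
    (hf_supp : ∀ p : ℝ × ℝ, p ∉ Set.Ioi (0:ℝ) ×ˢ Set.Ioi (0:ℝ) → f p = 0)
    (hf_int : Integrable f volume)
    (hdens : Measure.map (fun ω => (E ω, P ω)) μ
      = volume.withDensity (fun p => ENNReal.ofReal (f p)))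
    (𝒞 : ℝ × ℝ → ℝ)
    (h𝒞_smooth : ContDiffOn ℝ 1 𝒞 (Set.Icc (0:ℝ) 1 ×ˢ Set.Icc (0:ℝ) 1))
    (h𝒞_maps : ∀ p ∈ Set.Icc (0:ℝ) 1 ×ˢ Set.Icc (0:ℝ) 1, 𝒞 p ∈ Set.Icc (0:ℝ) 1) :
    ∀ fE fP SE SP a b : ℝ → ℝ, ∀ C1 C2 : ℝ → ℝ → ℝ,
      (∀ t, fE t = ∫ y in Set.Ioi (0:ℝ), f (t, y)) →
      (∀ t, fP t = ∫ x in Set.Ioi (0:ℝ), f (x, t)) →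
      (∀ t, SE t = ∫ x in Set.Ioi t, fE x) →
      (∀ t, SP t = ∫ y in Set.Ioi t, fP y) →
      (∀ t, a t = (∫ y in Set.Ioi t, f (t, y)) / fE t) →
      (∀ t, b t = (∫ x in Set.Ioi t, f (x, t)) / SE t) →
      (∀ u v, C1 u v = deriv (fun x => 𝒞 (x, v)) u) →
      (∀ u v, C2 u v = deriv (fun y => 𝒞 (u, y)) v) →
      -- `𝒞` is the survival copula of `(E,P)`
      (∀ s t : ℝ, 0 ≤ s → 0 ≤ t →
        (μ {ω | s < E ω ∧ t < P ω}).toReal = 𝒞 (SE s, SP t)) →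
      (∀ᵐ t ∂(volume.restrict (Set.Ici (0:ℝ))),
        0 < fE t →
          (∫ y in Set.Ioi t, f (t, y)) = fE t * C1 (SE t) (SP t)
            ∧ a t = C1 (SE t) (SP t)) ∧
      (∀ᵐ t ∂(volume.restrict (Set.Ici (0:ℝ))),
        (∫ x in Set.Ioi t, f (x, t)) = fP t * C2 (SE t) (SP t)
          ∧ (0 < SE t → b t = C2 (SE t) (SP t) * fP t / SE t)) := by
  intro fE fP SE SP a b C1 C2 hfE hfP hSE hSP ha hb hC1 hC2 hcop
  have hm : ∀ s t : ℝ, (μ {ω | s < E ω ∧ t < P ω}).toReal = ∫ p in Ioi s ×ˢ Ioi t, f p := by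
    intro s t
    have e : μ {ω | s < E ω ∧ t < P ω}
        = Measure.map (fun ω => (E ω, P ω)) μ (Ioi s ×ˢ Ioi t) := by
      rw [Measure.map_apply (hE.prodMk hP) (measurableSet_Ioi.prod measurableSet_Ioi)]
      rfl
    rw [e, hdens, withDensity_apply _ (measurableSet_Ioi.prod measurableSet_Ioi),
      integral_eq_lintegral_of_nonneg_ae (Eventually.of_forall hf_nonneg)
        hf_meas.aestronglyMeasurable]
  have hm1 : ∀ s t : ℝ, ∫ x in Ioi s, ∫ y in Ioi t, f (x, y)
      = (μ {ω | s < E ω ∧ t < P ω}).toReal := by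
    intro s t
    rw [hm, Measure.volume_eq_prod, setIntegral_prod]
    rw [← Measure.volume_eq_prod]
    exact hf_int.integrableOn
  have hm2 : ∀ s t : ℝ, ∫ y in Ioi t, ∫ x in Ioi s, f (x, y)
      = (μ {ω | s < E ω ∧ t < P ω}).toReal := by
    intro s t
    rw [hm, Measure.volume_eq_prod, ← Measure.prod_restrict, integral_prod_symm]
    rw [Measure.prod_restrict, ← Measure.volume_eq_prod]
    exact hf_int.integrableOn
  have h01 : ∀ A : Set Ω, (μ A).toReal ∈ Icc (0:ℝ) 1 := fun A =>
    ⟨ENNReal.toReal_nonneg, measureReal_le_one⟩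
  have hSE01 : ∀ t, SE t ∈ Icc (0:ℝ) 1 := by
    intro t
    rw [hSE, funext hfE, hm1]
    exact h01 _
  have hSP01 : ∀ t, SP t ∈ Icc (0:ℝ) 1 := by
    intro t
    rw [hSP, funext hfP, hm2]
    exact h01 _
  have hf_int' : Integrable (fun p : ℝ × ℝ => f p.swap) volume := by
    rw [Measure.volume_eq_prod] at hf_int ⊢
    exact hf_int.swap
  have hSEc : Continuous SE := by
    rw [funext hSE, funext hfE]
    exact tail_cont _ (part_int f hf_int 0)
  have hSPc : Continuous SP := by
    rw [funext hSP, funext hfP]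
    exact tail_cont _ (part_int _ hf_int' 0)
  have k1 := key f hf_nonneg hf_int 𝒞 h𝒞_smooth fE SE SP hfE hSE hSE01 hSP01 hSPc
    (fun s t hs ht => by rw [hm1, hcop s t hs ht])
  have k2 := key (fun p => f p.swap) (fun p => hf_nonneg _) hf_int' (fun p => 𝒞 p.swap)
    (h𝒞_smooth.comp (contDiff_snd.prodMk contDiff_fst).contDiffOn (fun p hp => ⟨hp.2, hp.1⟩))
    fP SP SE hfP hSP hSP01 hSE01 hSEc
    (fun s t hs ht => by
      simp only [Prod.swap_prod_mk]
      rw [hm2, hcop t s ht hs])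
  constructor
  · filter_upwards [k1] with t ht hpos
    rw [ha, hC1, ht]
    exact ⟨rfl, by field_simp⟩
  · filter_upwards [k2] with t ht
    simp only [Prod.swap_prod_mk] at ht
    rw [hb, hC2, ht]
    exact ⟨rfl, fun _ => by ring⟩
end

section
/- Let G be a finite nonempty set, let p ∈ ℝ^G satisfy p_g > 0 for all g ∈ G and Σ_{g∈G} p_g = 1, and let w ∈ ℝ^G satisfy w_g > 0 for all g ∈ G. For g ∈ G let e_g ∈ ℝ^G denote the standard basis vector, and set V = Σ_{g∈G} w_g·(e_g − p)(e_g − p)ᵀ. Then V is symmetric positive semidefinite and its kernel is exactly the one-dimensional span of the all-ones vector 𝟙 ∈ ℝ^G; in particular, rank(V) = |G| − 1. (This is item (v) of the paper's Lemma on the properties of R, Z and Γ: Ker(V(t)) = Vect(𝟙), proved via the decomposition V(t) = Σ_g w_g Ω_g with Ω_g = (i_g − p)(i_g − p)ᵀ.) -/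
open Matrix

/-- For `p` a strictly positive probability vector on a finite nonempty set `G`
and strictly positive weights `w`, the matrix `V = Σ_g w_g (e_g − p)(e_g − p)ᵀ` is symmetric
positive semidefinite, its kernel is exactly the span of the all-ones vector, and
`rank(V) = |G| − 1`. -/
theorem kernel_of_limit_covariance
    {G : Type*} [Fintype G] [DecidableEq G] [Nonempty G]
    (p w : G → ℝ) (hp : ∀ g, 0 < p g) (hpsum : ∑ g, p g = 1) (hw : ∀ g, 0 < w g)
    (V : Matrix G G ℝ)
    (hV : V = ∑ g, w g • Matrix.of (fun a b =>
      ((if a = g then (1:ℝ) else 0) - p a) * ((if b = g then (1:ℝ) else 0) - p b))) :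
    V.PosSemidef ∧
    (∀ u : G → ℝ, V.mulVec u = 0 ↔ ∃ c : ℝ, u = fun _ => c) ∧
    V.rank = Fintype.card G - 1 := by
  have hmv : ∀ u : G → ℝ, ∀ a, V.mulVec u a =
      ∑ g, w g * (((if a = g then (1:ℝ) else 0) - p a) * (u g - ∑ b, p b * u b)) := by
    intro u a
    have h1 : ∀ g, ∑ b, ((if b = g then (1:ℝ) else 0) - p b) * u b
        = u g - ∑ b, p b * u b := by
      intro g
      simp [sub_mul, Finset.sum_sub_distrib]
    rw [hV, Matrix.sum_mulVec, Finset.sum_apply]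
    refine Finset.sum_congr rfl fun g _ => ?_
    rw [← h1 g, Matrix.smul_mulVec, Pi.smul_apply, smul_eq_mul, Matrix.mulVec, dotProduct]
    refine congrArg (w g * ·) ?_
    rw [Finset.mul_sum]
    refine Finset.sum_congr rfl fun b _ => ?_
    simp only [Matrix.of_apply]
    ring
  have hker : ∀ u : G → ℝ, V.mulVec u = 0 ↔ ∃ c : ℝ, u = fun _ => c := by
    intro u
    constructor
    · intro h
      refine ⟨∑ b, p b * u b, ?_⟩
      have hq : ∑ g, w g * (u g - ∑ b, p b * u b) ^ 2 = 0 := by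
        have h0 : ∑ a, u a * V.mulVec u a = 0 := by simp [h]
        rw [← h0]
        have h2 : ∀ a, u a * V.mulVec u a = ∑ g, u a * (w g *
            (((if a = g then (1:ℝ) else 0) - p a) * (u g - ∑ b, p b * u b))) := by
          intro a
          rw [hmv, Finset.mul_sum]
        rw [Finset.sum_congr rfl fun a _ => h2 a]
        rw [Finset.sum_comm]
        refine Finset.sum_congr rfl fun g _ => ?_
        have h1 : ∑ a, ((if a = g then (1:ℝ) else 0) - p a) * u a
            = u g - ∑ b, p b * u b := by
          simp [sub_mul, Finset.sum_sub_distrib]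
        calc w g * (u g - ∑ b, p b * u b) ^ 2
            = (∑ a, ((if a = g then (1:ℝ) else 0) - p a) * u a)
                * (w g * (u g - ∑ b, p b * u b)) := by rw [h1]; ring
          _ = _ := by
            rw [Finset.sum_mul]
            refine Finset.sum_congr rfl fun a _ => ?_
            ring
      rw [Finset.sum_eq_zero_iff_of_nonneg
        (fun g _ => mul_nonneg (hw g).le (sq_nonneg _))] at hq
      funext g
      have := hq g (Finset.mem_univ g)
      rcases mul_eq_zero.1 this with h2 | h2
      · exact absurd h2 (hw g).ne'
      · exact sub_eq_zero.1 (pow_eq_zero_iff two_ne_zero |>.1 h2)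
    · rintro ⟨c, rfl⟩
      funext a
      rw [hmv]
      simp [← Finset.sum_mul, hpsum]
  refine ⟨?_, hker, ?_⟩
  · rw [hV]
    refine Matrix.posSemidef_sum _ fun g _ => ?_
    refine Matrix.PosSemidef.smul ?_ (hw g).le
    exact Matrix.posSemidef_vecMulVec_self_star
      (fun a => (if a = g then (1:ℝ) else 0) - p a)
  · have hk : LinearMap.ker V.mulVecLin = Submodule.span ℝ {(fun _ => 1 : G → ℝ)} := by
      ext u
      rw [LinearMap.mem_ker, Matrix.mulVecLin_apply, hker, Submodule.mem_span_singleton]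
      constructor
      · rintro ⟨c, rfl⟩
        exact ⟨c, by funext; simp⟩
      · rintro ⟨c, rfl⟩
        exact ⟨c, by funext; simp⟩
    have hr := LinearMap.finrank_range_add_finrank_ker V.mulVecLin
    have h1 : (fun _ => 1 : G → ℝ) ≠ 0 := by
      intro h
      exact one_ne_zero (congrFun h (Classical.arbitrary G))
    rw [hk, finrank_span_singleton h1, Module.finrank_fintype_fun_eq_card] at hr
    rw [Matrix.rank]
    omega
end
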